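/- arXiv:math/0611564 — 2 statements merged into one kernel-verified Lean document; each statement's English description precedes it below -/
import Mathlib

section
/- For all ε > 0, σ_x > 0, σ_k > 0 and all Schwartz functions f, g : ℝ → ℂ, the smoothed Wigner transform of the pair (f, ε g') satisfies, for every (x,k) ∈ ℝ²: W̃^{σ_x,σ_k;ε}[f, ε g'](x,k) = −2πik·W̃^{σ_x,σ_k;ε}[f,g](x,k) + (ε/2)·∂_x W̃^{σ_x,σ_k;ε}[f,g](x,k) − (iε σ_k²/2)·∂_k W̃^{σ_x,σ_k;ε}[f,g](x,k). -/
open Real MeasureTheory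

/-- The scaled Wigner transform `W^ε[f,g](x,k) = ∫ e^{-2πiky} f(x+εy/2) conj(g(x-εy/2)) dy`. -/
noncomputable def wigner (ε : ℝ) (f g : ℝ → ℂ) (x k : ℝ) : ℂ :=
  ∫ y : ℝ, Complex.exp (-(2 * π * Complex.I * k * y)) *
    f (x + ε * y / 2) * (starRingEnd ℂ) (g (x - ε * y / 2))

/-- The smoothed Wigner transform: the Wigner transform convolved with the normalized Gaussian
kernel `(2/(ε σx σk)) exp(-2π(x-x')²/(ε σx²) - 2π(k-k')²/(ε σk²))`. -/
noncomputable def swt (ε σx σk : ℝ) (f g : ℝ → ℂ) (x k : ℝ) : ℂ :=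
  (2 / (ε * σx * σk) : ℂ) *
    ∫ x' : ℝ, ∫ k' : ℝ,
      (Real.exp (-(2 * π * (x - x')^2 / (ε * σx^2)) - 2 * π * (k - k')^2 / (ε * σk^2)) : ℂ) *
        wigner ε f g x' k'

/-- Continuous functions decaying at least quadratically. -/
structure QDecay (f : ℝ → ℂ) : Prop where
  cont : Continuous f
  bdd : ∃ C : ℝ, ∀ a : ℝ, (1 + a ^ 2) * ‖f a‖ ≤ C

lemma qdecay_schwartz (f : SchwartzMap ℝ ℂ) : QDecay f := by
  refine ⟨f.continuous, ?_⟩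
  obtain ⟨C0, -, h0⟩ := f.decay 0 0
  obtain ⟨C2, -, h2⟩ := f.decay 2 0
  refine ⟨C0 + C2, fun a => ?_⟩
  have h0 := h0 a
  have h2 := h2 a
  simp only [norm_iteratedFDeriv_zero, pow_zero, one_mul, Real.norm_eq_abs, sq_abs] at h0 h2
  linarith

lemma qdecay_deriv (f : SchwartzMap ℝ ℂ) : QDecay (deriv f) :=
  qdecay_schwartz (SchwartzMap.derivCLM ℝ ℂ f)

lemma qdecay_id_mul (f : SchwartzMap ℝ ℂ) : QDecay (fun t => (t : ℂ) * f t) := by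
  refine ⟨by have := f.continuous; fun_prop, ?_⟩
  obtain ⟨C0, -, h0⟩ := f.decay 1 0
  obtain ⟨C2, -, h2⟩ := f.decay 3 0
  refine ⟨C0 + C2, fun a => ?_⟩
  have h0 := h0 a
  have h2 := h2 a
  simp only [norm_iteratedFDeriv_zero, pow_one, Real.norm_eq_abs] at h0 h2
  rw [norm_mul, Complex.norm_real, Real.norm_eq_abs]
  have : |a| ^ 3 = a ^ 2 * |a| := by rw [← sq_abs a]; ring
  rw [this] at h2
  linarith

/-- The integrand of the Wigner transform. -/
noncomputable def wint (ε : ℝ) (f g : ℝ → ℂ) (x k y : ℝ) : ℂ :=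
  Complex.exp (-(2 * π * Complex.I * k * y)) *
    f (x + ε * y / 2) * (starRingEnd ℂ) (g (x - ε * y / 2))

lemma wigner_eq (ε : ℝ) (f g : ℝ → ℂ) (x k : ℝ) : wigner ε f g x k = ∫ y, wint ε f g x k y := rfl

lemma wint_norm (ε : ℝ) (f g : ℝ → ℂ) (x k y : ℝ) :
    ‖wint ε f g x k y‖ = ‖f (x + ε * y / 2)‖ * ‖g (x - ε * y / 2)‖ := by
  have : -(2 * π * Complex.I * k * y) = ((-(2 * π * k * y) : ℝ) : ℂ) * Complex.I := by
    push_cast; ring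
  rw [wint, norm_mul, norm_mul, this, Complex.norm_exp_ofReal_mul_I, one_mul, RCLike.norm_conj]

lemma wint_bound {ε : ℝ} (hε : 0 < ε) {f g : ℝ → ℂ} (hf : QDecay f) (hg : QDecay g) :
    ∃ B : ℝ → ℝ, Integrable B ∧ ∀ x k y, ‖wint ε f g x k y‖ ≤ B y := by
  obtain ⟨C, hC⟩ := hf.bdd
  obtain ⟨D, hD⟩ := hg.bdd
  refine ⟨fun y => C * D * (1 + (ε / 2 * y) ^ 2)⁻¹, ?_, fun x k y => ?_⟩
  · exact (integrable_inv_one_add_sq.comp_mul_left' (by positivity : ε / 2 ≠ 0)).const_mul _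
  · beta_reduce
    rw [wint_norm, ← div_eq_mul_inv, le_div_iff₀ (by positivity)]
    have h1 := hC (x + ε * y / 2)
    have h2 := hD (x - ε * y / 2)
    set a := x + ε * y / 2 with ha
    set b := x - ε * y / 2 with hb
    have hab : ε / 2 * y = (a - b) / 2 := by rw [ha, hb]; ring
    rw [hab]
    have hC0 : 0 ≤ C := le_trans (by positivity) h1
    calc ‖f a‖ * ‖g b‖ * (1 + ((a - b) / 2) ^ 2)
        ≤ ‖f a‖ * ‖g b‖ * ((1 + a ^ 2) * (1 + b ^ 2)) := by
          gcongr
          nlinarith [sq_nonneg (a + b), sq_nonneg (a * b), sq_nonneg a, sq_nonneg b]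
      _ = ((1 + a ^ 2) * ‖f a‖) * ((1 + b ^ 2) * ‖g b‖) := by ring
      _ ≤ C * D := by gcongr

lemma wint_cont (ε : ℝ) {f g : ℝ → ℂ} (hf : QDecay f) (hg : QDecay g)
    {X : Type} [TopologicalSpace X] {a b c : X → ℝ} (ha : Continuous a) (hb : Continuous b)
    (hc : Continuous c) :
    Continuous (fun p => wint ε f g (a p) (b p) (c p)) := by
  have := hf.cont
  have := hg.cont
  unfold wint
  refine Continuous.mul (by fun_prop) (Complex.continuous_conj.comp (by fun_prop))

lemma wint_cont_y (ε : ℝ) {f g : ℝ → ℂ} (hf : QDecay f) (hg : QDecay g) (x k : ℝ) :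
    Continuous (fun y => wint ε f g x k y) :=
  wint_cont ε hf hg continuous_const continuous_const continuous_id

lemma wint_integrable {ε : ℝ} (hε : 0 < ε) {f g : ℝ → ℂ} (hf : QDecay f) (hg : QDecay g)
    (x k : ℝ) : Integrable (wint ε f g x k) := by
  obtain ⟨B, hB, h⟩ := wint_bound hε hf hg
  exact hB.mono' (wint_cont_y ε hf hg x k).aestronglyMeasurable (ae_of_all _ fun y => h x k y)

/-- Jointly continuous bounded functions on phase space. -/
structure BddCont (W : ℝ → ℝ → ℂ) : Prop where
  cont : Continuous (fun p : ℝ × ℝ => W p.1 p.2)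
  bdd : ∃ C : ℝ, ∀ x k : ℝ, ‖W x k‖ ≤ C

lemma wigner_bddCont {ε : ℝ} (hε : 0 < ε) {f g : ℝ → ℂ} (hf : QDecay f) (hg : QDecay g) :
    BddCont (wigner ε f g) := by
  obtain ⟨B, hB, h⟩ := wint_bound hε hf hg
  constructor
  · refine continuous_of_dominated (F := fun (p : ℝ × ℝ) y => wint ε f g p.1 p.2 y) (bound := B)
      (fun p => (wint_cont_y ε hf hg _ _).aestronglyMeasurable) (fun p => ae_of_all _ (h _ _)) hB
      (ae_of_all _ fun y => ?_)
    exact wint_cont ε hf hg continuous_fst continuous_snd continuous_const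
  · refine ⟨∫ y, B y, fun x k => ?_⟩
    exact norm_integral_le_of_norm_le hB (ae_of_all _ (h x k))

lemma hasDerivAt_conj_comp {g : ℝ → ℂ} {g' : ℂ} {t : ℝ} (h : HasDerivAt g g' t) :
    HasDerivAt (fun s => (starRingEnd ℂ) (g s)) ((starRingEnd ℂ) g') t := h.star

lemma wigner_hasDerivAt_x {ε : ℝ} (hε : 0 < ε) (f g : SchwartzMap ℝ ℂ) (x k : ℝ) :
    HasDerivAt (fun x => wigner ε f g x k)
      (wigner ε (deriv f) g x k + wigner ε f (deriv g) x k) x := by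
  obtain ⟨B, hB, h⟩ := wint_bound hε (qdecay_deriv f) (qdecay_schwartz g)
  obtain ⟨D, hD, h'⟩ := wint_bound hε (qdecay_schwartz f) (qdecay_deriv g)
  have I1 := wint_integrable hε (qdecay_deriv f) (qdecay_schwartz g) x k
  have I2 := wint_integrable hε (qdecay_schwartz f) (qdecay_deriv g) x k
  have key := (hasDerivAt_integral_of_dominated_loc_of_deriv_le (μ := volume) (x₀ := x)
    (F := fun x y => wint ε f g x k y) (s := Set.univ)
    (F' := fun x y => wint ε (deriv f) g x k y + wint ε f (deriv g) x k y)
    (bound := fun y => B y + D y) Filter.univ_mem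
    (Filter.Eventually.of_forall fun x =>
      (wint_cont_y ε (qdecay_schwartz f) (qdecay_schwartz g) x k).aestronglyMeasurable)
    (wint_integrable hε (qdecay_schwartz f) (qdecay_schwartz g) x k)
    (I1.add I2).aestronglyMeasurable
    (ae_of_all _ fun y x _ => (norm_add_le _ _).trans (add_le_add (h _ _ _) (h' _ _ _)))
    (hB.add hD)
    (ae_of_all _ fun y x _ => ?_)).2
  · rw [integral_add I1 I2] at key
    exact key
  · have hf := (f.differentiableAt (x := x + ε * y / 2)).hasDerivAt.comp_add_const x (ε * y / 2)
    have hg := hasDerivAt_conj_comp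
      ((g.differentiableAt (x := x - ε * y / 2)).hasDerivAt.comp_sub_const x (ε * y / 2))
    exact (hf.const_mul (Complex.exp (-(2 * π * Complex.I * k * y)))).mul hg

lemma wigner_hasDerivAt_k {ε : ℝ} (hε : 0 < ε) (f g : SchwartzMap ℝ ℂ) (x k : ℝ) :
    HasDerivAt (fun k => wigner ε f g x k)
      (-(2 * π * Complex.I / ε) * (wigner ε (fun t => (t : ℂ) * f t) g x k
        - wigner ε f (fun t => (t : ℂ) * g t) x k)) k := by
  obtain ⟨B, hB, h⟩ := wint_bound hε (qdecay_id_mul f) (qdecay_schwartz g)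
  obtain ⟨D, hD, h'⟩ := wint_bound hε (qdecay_schwartz f) (qdecay_id_mul g)
  have I1 := wint_integrable hε (qdecay_id_mul f) (qdecay_schwartz g) x k
  have I2 := wint_integrable hε (qdecay_schwartz f) (qdecay_id_mul g) x k
  have key := (hasDerivAt_integral_of_dominated_loc_of_deriv_le (μ := volume) (x₀ := k)
    (F := fun k y => wint ε f g x k y) (s := Set.univ)
    (F' := fun k y => -(2 * π * Complex.I / ε) * (wint ε (fun t => (t : ℂ) * f t) g x k y
      - wint ε f (fun t => (t : ℂ) * g t) x k y))
    (bound := fun y => ‖-(2 * π * Complex.I / ε : ℂ)‖ * (B y + D y)) Filter.univ_mem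
    (Filter.Eventually.of_forall fun k =>
      (wint_cont_y ε (qdecay_schwartz f) (qdecay_schwartz g) x k).aestronglyMeasurable)
    (wint_integrable hε (qdecay_schwartz f) (qdecay_schwartz g) x k)
    ((I1.sub I2).const_mul _).aestronglyMeasurable
    (ae_of_all _ fun y k _ => ?_)
    ((hB.add hD).const_mul _)
    (ae_of_all _ fun y k _ => ?_)).2
  · rw [integral_const_mul, integral_sub I1 I2] at key
    exact key
  · rw [norm_mul]
    gcongr
    exact (norm_sub_le _ _).trans (add_le_add (h _ _ _) (h' _ _ _))
  · have he : HasDerivAt (fun k : ℝ => Complex.exp (-(2 * π * Complex.I * k * y)))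
        (Complex.exp (-(2 * π * Complex.I * k * y)) * (-(2 * π * Complex.I * 1 * y))) k :=
      ((((Complex.ofRealCLM.hasDerivAt (x := k)).const_mul (2 * π * Complex.I)).mul_const
        (y : ℂ)).neg).cexp
    refine ((he.mul_const (f (x + ε * y / 2))).mul_const
      ((starRingEnd ℂ) (g (x - ε * y / 2)))).congr_deriv ?_
    have : (ε : ℂ) ≠ 0 := by exact_mod_cast hε.ne'
    simp only [wint, map_mul, Complex.conj_ofReal]
    push_cast
    field_simp
    ring

lemma wigner_ibp {ε : ℝ} (hε : 0 < ε) (f g : SchwartzMap ℝ ℂ) (x k : ℝ) :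
    ε * wigner ε f (deriv g) x k =
      -(4 * π * Complex.I * k) * wigner ε f g x k + ε * wigner ε (deriv f) g x k := by
  have I0 := wint_integrable hε (qdecay_schwartz f) (qdecay_schwartz g) x k
  have I1 := wint_integrable hε (qdecay_deriv f) (qdecay_schwartz g) x k
  have I2 := wint_integrable hε (qdecay_schwartz f) (qdecay_deriv g) x k
  have hd : ∀ y, HasDerivAt (wint ε f g x k)
      (-(2 * π * Complex.I * k) * wint ε f g x k y + (ε / 2) * wint ε (deriv f) g x k y
        - (ε / 2) * wint ε f (deriv g) x k y) y := by
    intro y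
    have he : HasDerivAt (fun y : ℝ => Complex.exp (-(2 * π * Complex.I * k * y)))
        (Complex.exp (-(2 * π * Complex.I * k * y)) * (-(2 * π * Complex.I * k * 1))) y :=
      (((Complex.ofRealCLM.hasDerivAt (x := y)).const_mul (2 * π * Complex.I * k)).neg).cexp
    have ha : HasDerivAt (fun y : ℝ => x + ε * y / 2) (ε * 1 / 2) y :=
      (((hasDerivAt_id y).const_mul ε).div_const 2).const_add x
    have hb : HasDerivAt (fun y : ℝ => x - ε * y / 2) (-(ε * 1 / 2)) y :=
      (((hasDerivAt_id y).const_mul ε).div_const 2).const_sub x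
    have hf := (f.differentiableAt (x := x + ε * y / 2)).hasDerivAt.scomp y ha
    have hg := hasDerivAt_conj_comp
      ((g.differentiableAt (x := x - ε * y / 2)).hasDerivAt.scomp y hb)
    refine ((he.mul hf).mul hg).congr_deriv ?_
    simp only [wint, Function.comp, Pi.mul_apply, Complex.real_smul, map_mul, Complex.conj_ofReal]
    push_cast
    ring
  have h := integral_eq_zero_of_hasDerivAt_of_integrable hd
    (((I0.const_mul _).add (I1.const_mul _)).sub (I2.const_mul _)) I0
  have J0 : Integrable fun y => -(2 * π * Complex.I * k) * wint ε f g x k y := I0.const_mul _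
  have J1 : Integrable fun y => (ε / 2 : ℂ) * wint ε (deriv f) g x k y := I1.const_mul _
  have J2 : Integrable fun y => (ε / 2 : ℂ) * wint ε f (deriv g) x k y := I2.const_mul _
  have J01 : Integrable fun y => -(2 * π * Complex.I * k) * wint ε f g x k y
    + (ε / 2 : ℂ) * wint ε (deriv f) g x k y := J0.add J1
  rw [integral_sub J01 J2, integral_add J0 J1, integral_const_mul, integral_const_mul,
    integral_const_mul, ← wigner_eq, ← wigner_eq, ← wigner_eq] at h
  linear_combination (-2) * h

/-- One-dimensional Gaussian. -/
noncomputable def gs (a t : ℝ) : ℂ := (Real.exp (-a * t ^ 2) : ℂ)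

lemma gs_integrable {a : ℝ} (ha : 0 < a) : Integrable (gs a) :=
  (integrable_exp_neg_mul_sq ha).ofReal

lemma mul_gs_integrable {a : ℝ} (ha : 0 < a) : Integrable (fun t : ℝ => (t : ℂ) * gs a t) := by
  have h := (integrable_mul_exp_neg_mul_sq ha).ofReal (𝕜 := ℂ)
  refine h.congr (ae_of_all _ fun t => ?_)
  simp [gs]

lemma gs_hasDerivAt (a t : ℝ) : HasDerivAt (gs a) (-(2 * a) * (t * gs a t)) t := by
  have h : HasDerivAt (fun t : ℝ => Real.exp (-a * t ^ 2))
      (Real.exp (-a * t ^ 2) * (-a * ((2 : ℕ) * t ^ (2 - 1) * 1))) t :=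
    (((hasDerivAt_id t).pow 2).const_mul (-a)).exp
  refine h.ofReal_comp.congr_deriv ?_
  simp only [gs]
  push_cast
  ring

lemma BddCont.integrable {W : ℝ → ℝ → ℂ} (hW : BddCont W) {K : ℝ × ℝ → ℂ}
    (hK : Integrable K) (x k : ℝ) :
    Integrable (fun p : ℝ × ℝ => K p * W (x - p.1) (k - p.2)) := by
  obtain ⟨C, hC⟩ := hW.bdd
  refine hK.mul_bdd (c := C) ?_ (ae_of_all _ fun p => hC _ _)
  exact (hW.cont.comp (by fun_prop : Continuous fun p : ℝ × ℝ => (x - p.1, k - p.2))).aestronglyMeasurable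

lemma BddCont.integrable_snd {W : ℝ → ℝ → ℂ} (hW : BddCont W) {K : ℝ → ℂ}
    (hK : Integrable K) (x k : ℝ) :
    Integrable (fun v : ℝ => K v * W x (k - v)) := by
  obtain ⟨C, hC⟩ := hW.bdd
  refine hK.mul_bdd (c := C) ?_ (ae_of_all _ fun p => hC _ _)
  exact (hW.cont.comp (by fun_prop : Continuous fun v : ℝ => (x, k - v))).aestronglyMeasurable

/-- Convolution of a kernel with a phase-space function. -/
noncomputable def conv2 (K : ℝ × ℝ → ℂ) (W : ℝ → ℝ → ℂ) (x k : ℝ) : ℂ :=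
  ∫ p : ℝ × ℝ, K p * W (x - p.1) (k - p.2)

lemma conv2_hasDerivAt_x {K : ℝ × ℝ → ℂ} (hK : Integrable K) {W W' : ℝ → ℝ → ℂ}
    (hW : BddCont W) (hW' : BddCont W')
    (hd : ∀ x k, HasDerivAt (fun x => W x k) (W' x k) x) (x k : ℝ) :
    HasDerivAt (fun x => conv2 K W x k) (conv2 K W' x k) x := by
  obtain ⟨C, hC⟩ := hW'.bdd
  refine (hasDerivAt_integral_of_dominated_loc_of_deriv_le (μ := volume) (x₀ := x)
    (F := fun x (p : ℝ × ℝ) => K p * W (x - p.1) (k - p.2)) (s := Set.univ)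
    (F' := fun x (p : ℝ × ℝ) => K p * W' (x - p.1) (k - p.2))
    (bound := fun p => ‖K p‖ * C) Filter.univ_mem
    (Filter.Eventually.of_forall fun x => (hW.integrable hK x k).aestronglyMeasurable)
    (hW.integrable hK x k) (hW'.integrable hK x k).aestronglyMeasurable
    (ae_of_all _ fun p x _ => ?_) (hK.norm.mul_const C)
    (ae_of_all _ fun p x _ => ?_)).2
  · rw [norm_mul]
    gcongr
    exact hC _ _
  · exact ((hd (x - p.1) (k - p.2)).comp_sub_const x p.1).const_mul (K p)

lemma conv2_hasDerivAt_k {K : ℝ × ℝ → ℂ} (hK : Integrable K) {W W' : ℝ → ℝ → ℂ}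
    (hW : BddCont W) (hW' : BddCont W')
    (hd : ∀ x k, HasDerivAt (fun k => W x k) (W' x k) k) (x k : ℝ) :
    HasDerivAt (fun k => conv2 K W x k) (conv2 K W' x k) k := by
  obtain ⟨C, hC⟩ := hW'.bdd
  refine (hasDerivAt_integral_of_dominated_loc_of_deriv_le (μ := volume) (x₀ := k)
    (F := fun k (p : ℝ × ℝ) => K p * W (x - p.1) (k - p.2)) (s := Set.univ)
    (F' := fun k (p : ℝ × ℝ) => K p * W' (x - p.1) (k - p.2))
    (bound := fun p => ‖K p‖ * C) Filter.univ_mem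
    (Filter.Eventually.of_forall fun k => (hW.integrable hK x k).aestronglyMeasurable)
    (hW.integrable hK x k) (hW'.integrable hK x k).aestronglyMeasurable
    (ae_of_all _ fun p k _ => ?_) (hK.norm.mul_const C)
    (ae_of_all _ fun p k _ => ?_)).2
  · rw [norm_mul]
    gcongr
    exact hC _ _
  · exact ((hd (x - p.1) (k - p.2)).comp_sub_const k p.2).const_mul (K p)

/-- The Gaussian kernel. -/
noncomputable def gk (a b : ℝ) (p : ℝ × ℝ) : ℂ := gs a p.1 * gs b p.2

/-- The Gaussian kernel multiplied by the second variable. -/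
noncomputable def vgk (a b : ℝ) (p : ℝ × ℝ) : ℂ := gs a p.1 * (p.2 * gs b p.2)

lemma gk_integrable {a b : ℝ} (ha : 0 < a) (hb : 0 < b) : Integrable (gk a b) :=
  (gs_integrable ha).mul_prod (gs_integrable hb)

lemma vgk_integrable {a b : ℝ} (ha : 0 < a) (hb : 0 < b) : Integrable (vgk a b) :=
  (gs_integrable ha).mul_prod (mul_gs_integrable hb)

lemma conv2_ibp {a b : ℝ} (ha : 0 < a) (hb : 0 < b) {W W' : ℝ → ℝ → ℂ}
    (hW : BddCont W) (hW' : BddCont W')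
    (hd : ∀ x k, HasDerivAt (fun k => W x k) (W' x k) k) (x k : ℝ) :
    conv2 (gk a b) W' x k = -(2 * b) * conv2 (vgk a b) W x k := by
  have h1 : conv2 (gk a b) W' x k
      = ∫ u : ℝ, ∫ v : ℝ, gk a b (u, v) * W' (x - u) (k - v) :=
    integral_prod _ (hW'.integrable (gk_integrable ha hb) x k)
  have h2 : conv2 (vgk a b) W x k
      = ∫ u : ℝ, ∫ v : ℝ, vgk a b (u, v) * W (x - u) (k - v) :=
    integral_prod _ (hW.integrable (vgk_integrable ha hb) x k)
  rw [h1, h2, ← integral_const_mul]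
  congr 1
  funext u
  have I1 := hW'.integrable_snd (gs_integrable hb) (x - u) k
  have I2 := hW.integrable_snd (mul_gs_integrable hb) (x - u) k
  have I0 := hW.integrable_snd (gs_integrable hb) (x - u) k
  have J2 : Integrable fun v : ℝ => -(2 * b : ℂ) * (v * gs b v * W (x - u) (k - v)) :=
    I2.const_mul _
  have hz := integral_eq_zero_of_hasDerivAt_of_integrable
    (f := fun v : ℝ => gs b v * W (x - u) (k - v))
    (f' := fun v : ℝ => -(2 * b : ℂ) * (v * gs b v * W (x - u) (k - v))
      - gs b v * W' (x - u) (k - v)) (fun v => ?_) (J2.sub I1) I0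
  · rw [integral_sub J2 I1, integral_const_mul] at hz
    simp only [gk, vgk, mul_assoc, integral_const_mul] at hz ⊢
    linear_combination (-gs a u) * hz
  · have h := (hd (x - u) (k - v)).comp_const_sub k v
    refine ((gs_hasDerivAt b v).mul h).congr_deriv ?_
    ring

lemma swt_eq {ε σx σk : ℝ} (hε : 0 < ε) (hσx : 0 < σx) (hσk : 0 < σk) {f g : ℝ → ℂ}
    (h : BddCont (wigner ε f g)) (x k : ℝ) :
    swt ε σx σk f g x k = (2 / (ε * σx * σk) : ℂ) *
      conv2 (gk (2 * π / (ε * σx ^ 2)) (2 * π / (ε * σk ^ 2))) (wigner ε f g) x k := by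
  have ha : 0 < 2 * π / (ε * σx ^ 2) := by positivity
  have hb : 0 < 2 * π / (ε * σk ^ 2) := by positivity
  set a := 2 * π / (ε * σx ^ 2) with hae
  set b := 2 * π / (ε * σk ^ 2) with hbe
  have h1 : conv2 (gk a b) (wigner ε f g) x k
      = ∫ u : ℝ, ∫ v : ℝ, gk a b (u, v) * wigner ε f g (x - u) (k - v) :=
    integral_prod _ (h.integrable (gk_integrable ha hb) x k)
  rw [swt, h1]
  congr 1
  rw [← integral_sub_left_eq_self _ volume x]
  congr 1
  funext u
  rw [← integral_sub_left_eq_self _ volume k]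
  congr 1
  funext v
  simp only [gk, gs, sub_sub_cancel]
  rw [← Complex.ofReal_mul, ← Real.exp_add]
  congr 4
  rw [hae, hbe]
  ring

/-- Identity (3d): the SWT of `(f, ε g')` in terms of the SWT of `(f,g)` and its
phase-space derivatives. -/
theorem swt_deriv_right (ε σx σk : ℝ) (hε : 0 < ε) (hσx : 0 < σx) (hσk : 0 < σk)
    (f g : SchwartzMap ℝ ℂ) (x k : ℝ) :
    swt ε σx σk (⇑f) (fun y => (ε : ℂ) * deriv (⇑g) y) x k =
      -(2 * π * Complex.I * k) * swt ε σx σk (⇑f) (⇑g) x k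
      + (ε / 2 : ℂ) * deriv (fun x' => swt ε σx σk (⇑f) (⇑g) x' k) x
      - Complex.I * ε * σk ^ 2 / 2 * deriv (fun k' => swt ε σx σk (⇑f) (⇑g) x k') k := by
  have hf := qdecay_schwartz f
  have hg := qdecay_schwartz g
  have ha : 0 < 2 * π / (ε * σx ^ 2) := by positivity
  have hb : 0 < 2 * π / (ε * σk ^ 2) := by positivity
  have hW := wigner_bddCont hε hf hg
  have hW1 := wigner_bddCont hε (qdecay_deriv f) hg
  have hW2 := wigner_bddCont hε hf (qdecay_deriv g)
  have hV1 := wigner_bddCont hε (qdecay_id_mul f) hg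
  have hV2 := wigner_bddCont hε hf (qdecay_id_mul g)
  have hX : BddCont (fun x k => wigner ε (deriv f) g x k + wigner ε f (deriv g) x k) := by
    obtain ⟨C, hC⟩ := hW1.bdd
    obtain ⟨D, hD⟩ := hW2.bdd
    exact ⟨hW1.cont.add hW2.cont, C + D, fun x k =>
      (norm_add_le _ _).trans (add_le_add (hC x k) (hD x k))⟩
  have hK : BddCont (fun x k => -(2 * π * Complex.I / ε) *
      (wigner ε (fun t => (t : ℂ) * f t) g x k - wigner ε f (fun t => (t : ℂ) * g t) x k)) := by
    obtain ⟨C, hC⟩ := hV1.bdd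
    obtain ⟨D, hD⟩ := hV2.bdd
    refine ⟨continuous_const.mul (hV1.cont.sub hV2.cont),
      ‖-(2 * π * Complex.I / ε : ℂ)‖ * (C + D), fun x k => ?_⟩
    rw [norm_mul]
    gcongr
    exact (norm_sub_le _ _).trans (add_le_add (hC x k) (hD x k))
  have hP : wigner ε f (fun y => (ε : ℂ) * deriv g y)
      = fun x k => (ε : ℂ) * wigner ε f (deriv g) x k := by
    funext x k
    rw [wigner, wigner, ← integral_const_mul]
    congr 1
    funext y
    rw [map_mul, Complex.conj_ofReal]
    ring
  have hPB : BddCont (wigner ε f (fun y => (ε : ℂ) * deriv g y)) := by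
    rw [hP]
    obtain ⟨D, hD⟩ := hW2.bdd
    refine ⟨continuous_const.mul hW2.cont, ‖(ε : ℂ)‖ * D, fun x k => ?_⟩
    rw [norm_mul]
    gcongr
    exact hD x k
  simp only [swt_eq hε hσx hσk hPB, swt_eq hε hσx hσk hW]
  set a := 2 * π / (ε * σx ^ 2) with hae
  set b := 2 * π / (ε * σk ^ 2) with hbe
  have hG := gk_integrable ha hb
  have hvG := vgk_integrable ha hb
  have dx := conv2_hasDerivAt_x hG hW hX (wigner_hasDerivAt_x hε f g) x k
  have dk := conv2_hasDerivAt_k hG hW hK (wigner_hasDerivAt_k hε f g) x k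
  rw [conv2_ibp ha hb hW hK (wigner_hasDerivAt_k hε f g) x k] at dk
  rw [(dx.const_mul _).deriv, (dk.const_mul _).deriv]
  have main : conv2 (gk a b) (wigner ε f (fun y => (ε : ℂ) * deriv g y)) x k
      = -(2 * π * Complex.I * k) * conv2 (gk a b) (wigner ε f g) x k
        + 2 * π * Complex.I * conv2 (vgk a b) (wigner ε f g) x k
        + ε / 2 * conv2 (gk a b)
          (fun x k => wigner ε (deriv f) g x k + wigner ε f (deriv g) x k) x k := by
    have J0 := (hW.integrable hG x k).const_mul (-(2 * π * Complex.I * k))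
    have J1 := (hW.integrable hvG x k).const_mul (2 * π * Complex.I)
    have J2 := (hX.integrable hG x k).const_mul (ε / 2 : ℂ)
    simp only [conv2]
    rw [← integral_const_mul, ← integral_const_mul, ← integral_const_mul,
      ← integral_add' J0 J1, ← integral_add' (J0.add J1) J2]
    congr 1
    funext p
    have hi := wigner_ibp hε f g (x - p.1) (k - p.2)
    simp only [hP, gk, vgk, Pi.add_apply]
    push_cast at hi ⊢
    linear_combination (gs a p.1 * gs b p.2 / 2) * hi
  rw [main]
  have hbs : (b : ℂ) * (ε * σk ^ 2) = 2 * π := by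
    have : b * (ε * σk ^ 2) = 2 * π := by rw [hbe]; field_simp
    exact_mod_cast this
  linear_combination (-(2 / (ε * σx * σk) : ℂ)) * Complex.I *
    conv2 (vgk a b) (wigner ε f g) x k * hbs
end

section
/- Exact Liouville equation for the Wigner transform of free Schrödinger evolution: let ε > 0 and let u : ℝ × ℝ → ℂ, (x,t) ↦ u(x,t), be smooth, Schwartz in x for each t with all Schwartz seminorms (in x, of u and of ∂_t u) locally bounded in t, and satisfy ε ∂_t u(x,t) = i(ε²/2) ∂²_x u(x,t) for all (x,t). Then W(x,k,t) := W^ε[u(·,t)](x,k) satisfies exactly ∂_t W(x,k,t) + 2πk ∂_x W(x,k,t) = 0 for all (x,k,t). -/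
open Real MeasureTheory

/-- The Wigner integrand. -/
noncomputable def wigP (ε k : ℝ) (f g : ℝ → ℂ) (x y : ℝ) : ℂ :=
  Complex.exp (-(2 * π * Complex.I * k * y)) *
    f (x + ε * y / 2) * (starRingEnd ℂ) (g (x - ε * y / 2))

lemma wigP_exp_norm (k y : ℝ) : ‖Complex.exp (-(2 * π * Complex.I * k * y))‖ = 1 := by
  have : (-(2 * π * Complex.I * k * y)) = ((-(2 * π * k * y) : ℝ) : ℂ) * Complex.I := by
    push_cast; ring
  rw [this, Complex.norm_exp_ofReal_mul_I]

lemma wigP_bound (ε k : ℝ) (f g : ℝ → ℂ) (C D R x y : ℝ)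
    (hf : ∀ z, (1 + z ^ 2) * ‖f z‖ ≤ C) (hg : ∀ z, (1 + z ^ 2) * ‖g z‖ ≤ D) (hx : |x| ≤ R) :
    ‖wigP ε k f g x y‖ ≤ ((2 + 2 * R ^ 2) * C * D) * (1 + ((ε / 2) * y) ^ 2)⁻¹ := by
  have hC : 0 ≤ C := le_trans (by positivity) (hf 0)
  have hgb : ‖g (x - ε * y / 2)‖ ≤ D := by
    refine le_trans ?_ (hg (x - ε * y / 2))
    nlinarith [norm_nonneg (g (x - ε * y / 2)),
      mul_nonneg (sq_nonneg (x - ε * y / 2)) (norm_nonneg (g (x - ε * y / 2)))]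
  have hx2 : x ^ 2 ≤ R ^ 2 := by
    have := abs_nonneg x
    rw [← sq_abs x]; gcongr
  set a := x + ε * y / 2 with ha
  have hs : (ε / 2) * y = a - x := by rw [ha]; ring
  have hw : 1 + ((ε / 2) * y) ^ 2 ≤ (2 + 2 * R ^ 2) * (1 + a ^ 2) := by
    rw [hs]
    nlinarith [sq_nonneg (a + x), sq_nonneg (R * a)]
  have hpos : 0 < 1 + ((ε / 2) * y) ^ 2 := by positivity
  have hfa : ‖f a‖ ≤ ((2 + 2 * R ^ 2) * C) * (1 + ((ε / 2) * y) ^ 2)⁻¹ := by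
    rw [← div_eq_mul_inv, le_div_iff₀ hpos]
    calc ‖f a‖ * (1 + ((ε / 2) * y) ^ 2) ≤ ‖f a‖ * ((2 + 2 * R ^ 2) * (1 + a ^ 2)) := by gcongr
      _ = (2 + 2 * R ^ 2) * ((1 + a ^ 2) * ‖f a‖) := by ring
      _ ≤ _ := by gcongr; exact hf a
  unfold wigP
  rw [norm_mul, norm_mul, wigP_exp_norm, one_mul, RCLike.norm_conj]
  calc _ ≤ (((2 + 2 * R ^ 2) * C) * (1 + ((ε / 2) * y) ^ 2)⁻¹) * D := by gcongr
    _ = _ := by ring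

lemma wigP_weight_integrable (ε : ℝ) (hε : 0 < ε) (C : ℝ) :
    Integrable (fun y : ℝ => C * (1 + ((ε / 2) * y) ^ 2)⁻¹) :=
  (integrable_inv_one_add_sq.comp_mul_left' (by positivity : ε / 2 ≠ 0)).const_mul C

lemma wigP_continuous (ε k : ℝ) (f g : ℝ → ℂ) (x : ℝ) (hf : Continuous f) (hg : Continuous g) :
    Continuous (wigP ε k f g x) := by
  unfold wigP
  have := Complex.continuous_conj
  fun_prop

lemma wigP_integrable (ε k : ℝ) (hε : 0 < ε) (f g : ℝ → ℂ) (C D x : ℝ)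
    (hfc : Continuous f) (hgc : Continuous g)
    (hf : ∀ z, (1 + z ^ 2) * ‖f z‖ ≤ C) (hg : ∀ z, (1 + z ^ 2) * ‖g z‖ ≤ D) :
    Integrable (wigP ε k f g x) :=
  (wigP_weight_integrable ε hε ((2 + 2 * |x| ^ 2) * C * D)).mono'
    (wigP_continuous ε k f g x hfc hgc).aestronglyMeasurable
    (Filter.Eventually.of_forall fun y => wigP_bound ε k f g C D |x| x y hf hg le_rfl)

/-- `x`-derivative of the integrand. -/
lemma wigP_hasDerivAt_x (ε k : ℝ) (f g f' g' : ℝ → ℂ) (x y : ℝ)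
    (hf : ∀ z, HasDerivAt f (f' z) z) (hg : ∀ z, HasDerivAt g (g' z) z) :
    HasDerivAt (fun x => wigP ε k f g x y) (wigP ε k f' g x y + wigP ε k f g' x y) x := by
  have h1 : HasDerivAt (fun x => f (x + ε * y / 2)) (f' (x + ε * y / 2)) x :=
    (hf _).comp_add_const x (ε * y / 2)
  have h2 : HasDerivAt (fun x => (starRingEnd ℂ) (g (x - ε * y / 2)))
      ((starRingEnd ℂ) (g' (x - ε * y / 2))) x :=
    ((hg _).comp_sub_const x (ε * y / 2)).star
  have h3 := (h1.const_mul (Complex.exp (-(2 * π * Complex.I * k * y)))).mul h2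
  exact h3

/-- `y`-derivative of the integrand. -/
lemma wigP_hasDerivAt_y (ε k : ℝ) (f g f' g' : ℝ → ℂ) (x y : ℝ)
    (hf : ∀ z, HasDerivAt f (f' z) z) (hg : ∀ z, HasDerivAt g (g' z) z) :
    HasDerivAt (fun y => wigP ε k f g x y) (-(2 * π * Complex.I * k) * wigP ε k f g x y
      + ε / 2 * wigP ε k f' g x y - ε / 2 * wigP ε k f g' x y) y := by
  have e : HasDerivAt (fun y : ℝ => ε * y / 2) (ε / 2) y := by
    simpa using ((hasDerivAt_id y).const_mul ε).div_const 2
  have h1 : HasDerivAt (fun y => f (x + ε * y / 2)) ((ε / 2) • f' (x + ε * y / 2)) y :=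
    (hf (x + ε * y / 2)).scomp y (e.const_add x)
  have h2 : HasDerivAt (fun y => (starRingEnd ℂ) (g (x - ε * y / 2)))
      ((starRingEnd ℂ) ((-(ε / 2)) • g' (x - ε * y / 2))) y :=
    ((hg (x - ε * y / 2)).scomp y (e.const_sub x)).star
  have h0 : HasDerivAt (fun y : ℝ => Complex.exp (-(2 * π * Complex.I * k * y)))
      (Complex.exp (-(2 * π * Complex.I * k * y)) * (-(2 * π * Complex.I * k))) y := by
    have : HasDerivAt (fun y : ℝ => (-(2 * π * Complex.I * k * y) : ℂ))
        (-(2 * π * Complex.I * k)) y := by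
      have h := ((Complex.ofRealCLM.hasDerivAt (x := y)).const_mul
        (2 * π * Complex.I * k : ℂ)).neg
      refine h.congr_deriv ?_
      simp
    exact this.cexp
  have h3 := (h0.mul h1).mul h2
  refine h3.congr_deriv ?_
  simp only [wigP, Pi.mul_apply, Complex.real_smul, map_mul, Complex.conj_ofReal]
  push_cast
  ring

/-- Exact Liouville ("free transport") equation for the Wigner transform of a solution of the
free Schrödinger equation `ε ∂_t u = i(ε²/2) ∂²_x u`: setting `W(x,k,t) = W^ε[u(·,t)](x,k)`,
one has `∂_t W + 2πk ∂_x W = 0` exactly. The hypotheses state that `u` is smooth on `ℝ × ℝ`,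
Schwartz in `x` for each `t`, with all Schwartz seminorms of `u(·,t)` and of `∂_t u(·,t)`
locally bounded in `t`. -/
theorem wigner_free_liouville (ε : ℝ) (hε : 0 < ε) (u : ℝ → ℝ → ℂ)
    (hu_smooth : ContDiff ℝ (⊤ : ℕ∞) (fun p : ℝ × ℝ => u p.1 p.2))
    (hu_schwartz : ∀ n m : ℕ, ∀ T : ℝ, ∃ C : ℝ, ∀ t x : ℝ, |t| ≤ T →
      |x| ^ n * ‖iteratedDeriv m (fun x' => u x' t) x‖ ≤ C)
    (hut_schwartz : ∀ n m : ℕ, ∀ T : ℝ, ∃ C : ℝ, ∀ t x : ℝ, |t| ≤ T →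
      |x| ^ n * ‖iteratedDeriv m (fun x' => deriv (fun s => u x' s) t) x‖ ≤ C)
    (heq : ∀ x t : ℝ, (ε : ℂ) * deriv (fun s => u x s) t =
      Complex.I * ε ^ 2 / 2 * iteratedDeriv 2 (fun x' => u x' t) x) :
    ∀ x k t : ℝ,
      deriv (fun s => wigner ε (fun x' => u x' s) (fun x' => u x' s) x k) t
        + 2 * π * k * deriv (fun x' => wigner ε (fun y => u y t) (fun y => u y t) x' k) x = 0 := by
  intro x k t
  -- slices
  have hsl : ∀ s, ContDiff ℝ (⊤ : ℕ∞) (fun x' => u x' s) := fun s =>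
    hu_smooth.comp (contDiff_id.prodMk contDiff_const)
  have hslt : ∀ z, ContDiff ℝ (⊤ : ℕ∞) (fun s => u z s) := fun z =>
    hu_smooth.comp (contDiff_const.prodMk contDiff_id)
  obtain ⟨f, hfdef⟩ : ∃ f : ℕ → ℝ → ℝ → ℂ,
      f = fun m s => iteratedDeriv m (fun x' => u x' s) := ⟨_, rfl⟩
  have hf0 : ∀ s, f 0 s = fun x' => u x' s := fun s => by rw [hfdef]; simp
  have hfd : ∀ m s z, HasDerivAt (f m s) (f (m + 1) s z) z := by
    intro m s z
    subst hfdef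
    have := (hsl s).differentiable_iteratedDeriv m (by exact_mod_cast WithTop.coe_lt_top m)
    have h := (this z).hasDerivAt
    rw [← iteratedDeriv_succ] at h
    exact h
  have hfc : ∀ m s, Continuous (f m s) := fun m s =>
    continuous_iff_continuousAt.2 fun z => (hfd m s z).continuousAt
  have hfb : ∀ m, ∀ T : ℝ, ∃ C, ∀ s, |s| ≤ T → ∀ z, (1 + z ^ 2) * ‖f m s z‖ ≤ C := by
    intro m T
    obtain ⟨C0, h0⟩ := hu_schwartz 0 m T
    obtain ⟨C2, h2⟩ := hu_schwartz 2 m T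
    refine ⟨C0 + C2, fun s hs z => ?_⟩
    have a := h0 s z hs
    have b := h2 s z hs
    rw [sq_abs] at b
    rw [hfdef]
    simp only [pow_zero, one_mul] at a
    rw [add_mul, one_mul]
    exact add_le_add a b
  have hεc : (ε : ℂ) ≠ 0 := by exact_mod_cast hε.ne'
  have hft : ∀ z s, HasDerivAt (fun s => f 0 s z) (Complex.I * ε / 2 * f 2 s z) s := by
    intro z s
    have h := ((hslt z).differentiable (by simp) s).hasDerivAt
    have e := heq z s
    have e2 : deriv (fun s => u z s) s = Complex.I * ε / 2 * f 2 s z := by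
      apply mul_left_cancel₀ hεc
      rw [e, hfdef]; ring
    rw [e2] at h
    simpa only [hf0] using h
  choose B hB using hfb
  -- integrability
  have hint : ∀ m n s, Integrable (wigP ε k (f m s) (f n s) x) := fun m n s =>
    wigP_integrable ε k hε _ _ _ _ x (hfc m s) (hfc n s)
      (hB m |s| s le_rfl) (hB n |s| s le_rfl)
  -- x derivative
  have hDx : HasDerivAt (fun x' => ∫ y, wigP ε k (f 0 t) (f 0 t) x' y)
      (∫ y, (wigP ε k (f 1 t) (f 0 t) x y + wigP ε k (f 0 t) (f 1 t) x y)) x := by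
    refine (hasDerivAt_integral_of_dominated_loc_of_deriv_le
      (F := fun x' y => wigP ε k (f 0 t) (f 0 t) x' y)
      (F' := fun x' y => wigP ε k (f 1 t) (f 0 t) x' y + wigP ε k (f 0 t) (f 1 t) x' y)
      (bound := fun y =>
        ((2 + 2 * (|x| + 1) ^ 2) * B 1 |t| * B 0 |t|) * (1 + ((ε / 2) * y) ^ 2)⁻¹ +
        ((2 + 2 * (|x| + 1) ^ 2) * B 0 |t| * B 1 |t|) * (1 + ((ε / 2) * y) ^ 2)⁻¹)
      (Metric.ball_mem_nhds x one_pos) ?_ (hint 0 0 t) ?_ ?_ ?_ ?_).2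
    · exact Filter.Eventually.of_forall fun x' =>
        (wigP_continuous ε k _ _ x' (hfc 0 t) (hfc 0 t)).aestronglyMeasurable
    · exact ((wigP_continuous ε k _ _ x (hfc 1 t) (hfc 0 t)).add
        (wigP_continuous ε k _ _ x (hfc 0 t) (hfc 1 t))).aestronglyMeasurable
    · refine Filter.Eventually.of_forall fun y x' hx' => ?_
      have hR : |x'| ≤ |x| + 1 := by
        rw [Metric.mem_ball, Real.dist_eq] at hx'
        have := abs_sub_abs_le_abs_sub x' x
        linarith
      exact (norm_add_le _ _).trans (add_le_add
        (wigP_bound ε k _ _ _ _ _ x' y (hB 1 |t| t le_rfl) (hB 0 |t| t le_rfl) hR)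
        (wigP_bound ε k _ _ _ _ _ x' y (hB 0 |t| t le_rfl) (hB 1 |t| t le_rfl) hR))
    · exact (wigP_weight_integrable ε hε _).add (wigP_weight_integrable ε hε _)
    · exact Filter.Eventually.of_forall fun y x' _ =>
        wigP_hasDerivAt_x ε k _ _ _ _ x' y (hfd 0 t) (hfd 0 t)
  -- t derivative
  have hDt : HasDerivAt (fun s => ∫ y, wigP ε k (f 0 s) (f 0 s) x y)
      (∫ y, (Complex.I * ε / 2) * (wigP ε k (f 2 t) (f 0 t) x y - wigP ε k (f 0 t) (f 2 t) x y))
      t := by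
    refine (hasDerivAt_integral_of_dominated_loc_of_deriv_le
      (F := fun s y => wigP ε k (f 0 s) (f 0 s) x y)
      (F' := fun s y => (Complex.I * ε / 2) *
        (wigP ε k (f 2 s) (f 0 s) x y - wigP ε k (f 0 s) (f 2 s) x y))
      (bound := fun y => ‖(Complex.I * ε / 2 : ℂ)‖ * (
        ((2 + 2 * |x| ^ 2) * B 2 (|t| + 1) * B 0 (|t| + 1)) * (1 + ((ε / 2) * y) ^ 2)⁻¹ +
        ((2 + 2 * |x| ^ 2) * B 0 (|t| + 1) * B 2 (|t| + 1)) * (1 + ((ε / 2) * y) ^ 2)⁻¹))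
      (Metric.ball_mem_nhds t one_pos) ?_ (hint 0 0 t) ?_ ?_ ?_ ?_).2
    · exact Filter.Eventually.of_forall fun s =>
        (wigP_continuous ε k _ _ x (hfc 0 s) (hfc 0 s)).aestronglyMeasurable
    · exact (((wigP_continuous ε k _ _ x (hfc 2 t) (hfc 0 t)).sub
        (wigP_continuous ε k _ _ x (hfc 0 t) (hfc 2 t))).const_smul
          (Complex.I * ε / 2 : ℂ)).aestronglyMeasurable
    · refine Filter.Eventually.of_forall fun y s hs => ?_
      have hT : |s| ≤ |t| + 1 := by
        rw [Metric.mem_ball, Real.dist_eq] at hs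
        have := abs_sub_abs_le_abs_sub s t
        linarith
      rw [norm_mul]
      refine mul_le_mul_of_nonneg_left ?_ (norm_nonneg _)
      exact (norm_sub_le _ _).trans (add_le_add
        (wigP_bound ε k _ _ _ _ _ x y (hB 2 _ s hT) (hB 0 _ s hT) le_rfl)
        (wigP_bound ε k _ _ _ _ _ x y (hB 0 _ s hT) (hB 2 _ s hT) le_rfl))
    · exact ((wigP_weight_integrable ε hε _).add (wigP_weight_integrable ε hε _)).const_mul _
    · refine Filter.Eventually.of_forall fun y s _ => ?_
      have h1 := hft (x + ε * y / 2) s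
      have h2 : HasDerivAt (fun s => (starRingEnd ℂ) (f 0 s (x - ε * y / 2)))
          ((starRingEnd ℂ) (Complex.I * ε / 2 * f 2 s (x - ε * y / 2))) s :=
        (hft (x - ε * y / 2) s).star
      refine ((h1.const_mul (Complex.exp (-(2 * π * Complex.I * k * y)))).mul h2).congr_deriv ?_
      simp only [wigP, map_mul, map_div₀, Complex.conj_ofReal, Complex.conj_I, map_ofNat]
      ring
  -- integration by parts
  have hzero := integral_eq_zero_of_hasDerivAt_of_integrable
    (fun y => (wigP_hasDerivAt_y ε k _ _ _ _ x y (hfd 1 t) (hfd 0 t)).add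
      (wigP_hasDerivAt_y ε k _ _ _ _ x y (hfd 0 t) (hfd 1 t)))
    (((((hint 1 0 t).const_mul _).add ((hint 2 0 t).const_mul _)).sub
      ((hint 1 1 t).const_mul _)).add
     ((((hint 0 1 t).const_mul _).add ((hint 1 1 t).const_mul _)).sub
      ((hint 0 2 t).const_mul _)))
    ((hint 1 0 t).add (hint 0 1 t))
  have hDt' := hDt.deriv
  have hDx' := hDx.deriv
  simp only [hf0] at hDt' hDx'
  change deriv (fun s => ∫ y, wigP ε k (fun x' => u x' s) (fun x' => u x' s) x y) t
    + 2 * π * k * deriv (fun x' => ∫ y, wigP ε k (fun y => u y t) (fun y => u y t) x' y) x = 0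
  have i1 : Integrable (fun y => Complex.I * ε / 2 *
      (wigP ε k (f 2 t) (f 0 t) x y - wigP ε k (f 0 t) (f 2 t) x y)) :=
    ((hint 2 0 t).sub (hint 0 2 t)).const_mul _
  have i2 : Integrable (fun y => 2 * π * k *
      (wigP ε k (f 1 t) (f 0 t) x y + wigP ε k (f 0 t) (f 1 t) x y)) :=
    ((hint 1 0 t).add (hint 0 1 t)).const_mul _
  rw [hDt', hDx', ← hf0 t, ← integral_const_mul, ← integral_add i1 i2]
  rw [← mul_zero Complex.I, ← hzero, ← integral_const_mul]
  refine integral_congr_ae (Filter.Eventually.of_forall fun y => ?_)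
  simp only [zero_add, one_add_one_eq_two]
  linear_combination ((2 * π * k) * (wigP ε k (f 1 t) (f 0 t) x y + wigP ε k (f 0 t) (f 1 t) x y))
    * Complex.I_sq
end
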